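/- Let X be a real 2n×2n matrix such that the matrix Y = -Xᵀ·J·X·J has no zero and no negative real eigenvalues (i.e. no real number t ≤ 0 lies in the spectrum of Y). Then there exists a real skew-symmetric matrix A (Aᵀ = -A) and a real symplectic matrix S (S·J·Sᵀ = J) such that X = S·A. -/

import Mathlib

open Matrix

/-- The standard symplectic form matrix `J = [[0, -I_n], [I_n, 0]]`. -/
def symplJ (n : ℕ) : Matrix (Fin n ⊕ Fin n) (Fin n ⊕ Fin n) ℝ :=
  Matrix.fromBlocks 0 (-1) 1 0

/-- The block diagonal matrix `D = [[I_n, 0], [0, -I_n]]`. -/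
def Dmat (n : ℕ) : Matrix (Fin n ⊕ Fin n) (Fin n ⊕ Fin n) ℝ :=
  Matrix.fromBlocks 1 0 0 (-1)

open Polynomial in
/-- An irreducible real polynomial without nonpositive roots has a square root of the variable
in its residue field. -/
lemma exists_dvd_sq_sub_X_of_irreducible {f : ℝ[X]} (hf : Irreducible f)
    (hroot : ∀ t : ℝ, t ≤ 0 → ¬ f.IsRoot t) : ∃ q : ℝ[X], f ∣ q ^ 2 - X := by
  obtain ⟨z, hz⟩ := IsAlgClosed.exists_aeval_eq_zero ℂ f (degree_pos_of_irreducible hf).ne'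
  have key : ∀ q : ℝ[X], aeval z q ^ 2 = z → ∃ q : ℝ[X], f ∣ q ^ 2 - X := by
    intro q hq
    refine ⟨q, ?_⟩
    have hmin : minpoly ℝ z ∣ q ^ 2 - X := minpoly.dvd ℝ z (by simp [hq])
    rw [← minpoly.eq_of_irreducible hf hz] at hmin
    exact dvd_of_mul_right_dvd hmin
  by_cases him : z.im = 0
  · have hzr : z = (z.re : ℂ) := Complex.ext rfl (by simpa using him)
    have hr : f.IsRoot z.re := by
      rw [hzr] at hz
      have h := aeval_algebraMap_apply ℂ z.re f
      rw [Complex.coe_algebraMap, hz] at h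
      simpa [IsRoot, aeval_def] using h.symm
    have hpos : 0 < z.re := by
      by_contra hneg
      exact hroot _ (not_lt.mp hneg) hr
    refine key (C (Real.sqrt z.re)) ?_
    rw [aeval_C, Complex.coe_algebraMap, ← Complex.ofReal_pow, Real.sq_sqrt hpos.le, ← hzr]
  · obtain ⟨w, hw⟩ := IsAlgClosed.exists_pow_nat_eq z (n := 2) (by norm_num)
    refine key (C (w.re - w.im / z.im * z.re) + C (w.im / z.im) * X) ?_
    rw [← hw]
    congr 1
    rw [hw]
    apply Complex.ext <;> simp [him]

open Polynomial in
/-- Hensel-type lifting of a square root of the variable to powers of an irreducible. -/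
lemma exists_pow_dvd_sq_sub_X_of_irreducible {f : ℝ[X]} (hf : Irreducible f)
    (hroot : ∀ t : ℝ, t ≤ 0 → ¬ f.IsRoot t) (k : ℕ) : ∃ q : ℝ[X], f ^ (k + 1) ∣ q ^ 2 - X := by
  induction k with
  | zero => simpa using exists_dvd_sq_sub_X_of_irreducible hf hroot
  | succ k ih =>
    obtain ⟨q, g, hg⟩ := ih
    have hq : ¬ f ∣ q := by
      intro h
      have hX : f ∣ X := by
        have h₁ : f ∣ q ^ 2 - X := hg ▸ (dvd_pow_self f k.succ_ne_zero).mul_right g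
        exact (dvd_sub_right (dvd_pow h two_ne_zero)).mp h₁
      have h₀ : X ∣ f := hf.dvd_symm irreducible_X hX
      rw [X_dvd_iff, coeff_zero_eq_eval_zero] at h₀
      exact hroot 0 le_rfl h₀
    obtain ⟨u, v, huv⟩ := (hf.coprime_iff_not_dvd).mpr hq
    have hC : (C (1 / 2) : ℝ[X]) * 2 = 1 := by
      rw [← C_ofNat, ← C_mul]
      norm_num
    refine ⟨q - f ^ (k + 1) * (C (1 / 2) * g * v),
      g * u + f ^ k * (C (1 / 2) * g * v) ^ 2, ?_⟩
    linear_combination hg - f ^ (k + 1) * g * huv - f ^ (k + 1) * g * v * q * hC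

open Polynomial in
/-- The variable is a square modulo any real polynomial without nonpositive roots. -/
lemma exists_dvd_sq_sub_X (p : ℝ[X]) (hp : p ≠ 0) (hroot : ∀ t : ℝ, t ≤ 0 → ¬ p.IsRoot t) :
    ∃ q : ℝ[X], p ∣ q ^ 2 - X := by
  induction p using UniqueFactorizationMonoid.induction_on_coprime with
  | h0 => exact absurd rfl hp
  | h1 h => exact ⟨0, h.dvd⟩
  | hpr i h =>
    rename_i f
    rcases i with _ | k
    · exact ⟨0, by simp⟩
    · exact exists_pow_dvd_sq_sub_X_of_irreducible h.irreducible
        (fun t ht hr => hroot t ht (hr.dvd (dvd_pow_self f k.succ_ne_zero))) k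
  | hcp h hx hy =>
    rename_i a b
    obtain ⟨q, hq⟩ := hx (left_ne_zero_of_mul hp)
      (fun t ht hr => hroot t ht (hr.dvd (dvd_mul_right a b)))
    obtain ⟨r, hr⟩ := hy (right_ne_zero_of_mul hp)
      (fun t ht hr => hroot t ht (hr.dvd (dvd_mul_left b a)))
    have hab : IsCoprime a b := h.isCoprime
    obtain ⟨u, v, huv⟩ := hab
    refine ⟨u * a * r + v * b * q, IsCoprime.mul_dvd ⟨u, v, huv⟩ ?_ ?_⟩
    · have : (u * a * r + v * b * q) ^ 2 - X
          = q ^ 2 - X + a * (u * (r - q) * (u * a * r + v * b * q + q)) := by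
        linear_combination (q * (u * a * r + v * b * q + q)) * huv
      rw [this]
      exact dvd_add hq (dvd_mul_right _ _)
    · have : (u * a * r + v * b * q) ^ 2 - X
          = r ^ 2 - X + b * (v * (q - r) * (u * a * r + v * b * q + r)) := by
        linear_combination (r * (u * a * r + v * b * q + r)) * huv
      rw [this]
      exact dvd_add hr (dvd_mul_right _ _)

open Polynomial in
/-- A real matrix without nonpositive real eigenvalues has a square root that is a real polynomial
in the matrix. -/
lemma Matrix.exists_aeval_sq_eq {m : Type*} [Fintype m] [DecidableEq m] (Y : Matrix m m ℝ)
    (hY : ∀ t : ℝ, t ≤ 0 → t ∉ spectrum ℝ Y) : ∃ q : ℝ[X], aeval Y q ^ 2 = Y := by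
  obtain ⟨q, g, hg⟩ := exists_dvd_sq_sub_X Y.charpoly Y.charpoly_monic.ne_zero
    (fun t ht hr => hY t ht (Matrix.mem_spectrum_iff_isRoot_charpoly.mpr hr))
  refine ⟨q, ?_⟩
  have h := congrArg (aeval Y) hg
  simpa [Matrix.aeval_self_charpoly, sub_eq_zero] using h

open Polynomial in
/-- An intertwining relation between two matrices passes to polynomials in them. -/
lemma Matrix.mul_aeval_eq_aeval_mul {m R : Type*} [Fintype m] [DecidableEq m] [CommRing R]
    {J Y Z : Matrix m m R} (h : J * Z = Y * J) (q : R[X]) :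
    J * aeval Z q = aeval Y q * J := by
  induction q using Polynomial.induction_on' with
  | add p q hp hq => rw [map_add, map_add, mul_add, add_mul, hp, hq]
  | monomial k a =>
    have hk : SemiconjBy J (Z ^ k) (Y ^ k) := SemiconjBy.pow_right h k
    rw [aeval_monomial, aeval_monomial, ← Algebra.smul_def, ← Algebra.smul_def, mul_smul_comm,
      smul_mul_assoc, hk.eq]

open Polynomial in
lemma Matrix.transpose_aeval {m R : Type*} [Fintype m] [DecidableEq m] [CommRing R]
    (Y : Matrix m m R) (q : R[X]) : (aeval Y q)ᵀ = aeval Yᵀ q := by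
  induction q using Polynomial.induction_on' with
  | add p q hp hq => rw [map_add, map_add, transpose_add, hp, hq]
  | monomial k a =>
    rw [aeval_monomial, aeval_monomial, ← Algebra.smul_def, ← Algebra.smul_def, transpose_smul,
      transpose_pow]

lemma symplJ_transpose (n : ℕ) : (symplJ n)ᵀ = -symplJ n := by
  simp [symplJ, Matrix.fromBlocks_transpose, Matrix.fromBlocks_neg]

lemma symplJ_mul_self (n : ℕ) : symplJ n * symplJ n = -1 := by
  simp [symplJ, Matrix.fromBlocks_multiply, ← Matrix.fromBlocks_one, Matrix.fromBlocks_neg]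

/-- If the transpose of `S` preserves the symplectic form, so does `S`. -/
lemma symplectic_of_transpose_mul {n : ℕ} {S : Matrix (Fin n ⊕ Fin n) (Fin n ⊕ Fin n) ℝ}
    (h : Sᵀ * symplJ n * S = symplJ n) : S * symplJ n * Sᵀ = symplJ n := by
  have hJ := symplJ_mul_self n
  have h₁ : -(symplJ n * Sᵀ * symplJ n) * S = 1 := by
    rw [neg_mul, mul_assoc, mul_assoc, ← mul_assoc Sᵀ, h, hJ, neg_neg]
  have h₂ := mul_eq_one_comm.mp h₁
  calc S * symplJ n * Sᵀ
      = S * -(symplJ n * Sᵀ * symplJ n) * symplJ n := by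
        have : symplJ n * Sᵀ * symplJ n * symplJ n = -(symplJ n * Sᵀ) := by
          rw [mul_assoc _ (symplJ n) (symplJ n), hJ, mul_neg, mul_one]
        rw [mul_assoc S (-_), neg_mul, this, neg_neg, mul_assoc]
    _ = symplJ n := by rw [h₂, one_mul]

/-- Corollary: if `Y = -X^T*J*X*J` has no real eigenvalue `t ≤ 0`, then `X = S * A` with `A` skew-symmetric and `S` symplectic. -/
theorem stmt_10 (n : ℕ) (X : Matrix (Fin n ⊕ Fin n) (Fin n ⊕ Fin n) ℝ)
    (hY : ∀ t : ℝ, t ≤ 0 → t ∉ spectrum ℝ (-(Xᵀ * symplJ n * X * symplJ n))) :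
    ∃ A S : Matrix (Fin n ⊕ Fin n) (Fin n ⊕ Fin n) ℝ,
      Aᵀ = -A ∧ S * symplJ n * Sᵀ = symplJ n ∧ X = S * A := by
  obtain ⟨q, hq⟩ := Matrix.exists_aeval_sq_eq _ hY
  have hunit := spectrum.zero_notMem_iff ℝ |>.mp (hY 0 le_rfl)
  have hJ := symplJ_mul_self n
  have hJT := symplJ_transpose n
  set J := symplJ n
  set Y := -(Xᵀ * J * X * J) with hYdef
  have hYJ : Y * J = Xᵀ * J * X := by
    rw [hYdef, neg_mul, mul_assoc _ J J, hJ, mul_neg, mul_one, neg_neg]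
  have hJY : J * Yᵀ = Y * J := by
    rw [hYJ, hYdef]
    simp only [transpose_neg, transpose_mul, transpose_transpose, hJT, neg_mul, mul_neg, neg_neg]
    rw [← mul_assoc J J, hJ]
    simp [mul_assoc]
  have hB := Matrix.mul_aeval_eq_aeval_mul hJY q
  rw [← Matrix.transpose_aeval] at hB
  set B := Polynomial.aeval Y q
  have hBu : IsUnit B := (isUnit_pow_iff two_ne_zero).mp (hq ▸ hunit)
  have hJu : IsUnit J := IsUnit.of_mul_eq_one (-J) (by rw [mul_neg, hJ, neg_neg])
  obtain ⟨A, hA⟩ : ∃ A, A = -(B * J) := ⟨_, rfl⟩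
  have hAT : Aᵀ = -A := by
    rw [hA, transpose_neg, transpose_mul, hJT, neg_mul, neg_neg, neg_neg, hB]
  have hAu : IsUnit A := hA ▸ (hBu.mul hJu).neg
  have hAJA : A * J * A = -(Xᵀ * J * X) := by
    have hAJ : A * J = B := by
      rw [hA, neg_mul, mul_assoc, hJ, mul_neg, mul_one, neg_neg]
    rw [hAJ, hA, mul_neg, ← mul_assoc, ← pow_two, hq, hYJ]
  have hdet : IsUnit A.det := (Matrix.isUnit_iff_isUnit_det A).mp hAu
  refine ⟨A, X * A⁻¹, hAT, symplectic_of_transpose_mul ?_, ?_⟩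
  · have hK : Xᵀ * J * X = -(A * J * A) := by rw [hAJA, neg_neg]
    have hAi : (A⁻¹)ᵀ = -A⁻¹ := by
      rw [transpose_nonsing_inv, hAT]
      exact Matrix.inv_eq_left_inv (by rw [neg_mul_neg, Matrix.nonsing_inv_mul A hdet])
    calc (X * A⁻¹)ᵀ * J * (X * A⁻¹) = -A⁻¹ * (Xᵀ * J * X) * A⁻¹ := by
          rw [transpose_mul, hAi]
          simp only [mul_assoc]
      _ = A⁻¹ * A * J * (A * A⁻¹) := by
          rw [hK, neg_mul_neg]
          simp only [mul_assoc]
      _ = J := by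
          rw [Matrix.nonsing_inv_mul A hdet, Matrix.mul_nonsing_inv A hdet, one_mul, mul_one]
  · rw [mul_assoc, Matrix.nonsing_inv_mul A hdet, mul_one]
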